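/- arXiv:2111.00456 — 11 statements merged into one kernel-verified Lean document; each statement's English description precedes it below -/
import Mathlib

section
/- For every infinite set M, there is no surjection from ω × M onto the power set 𝒫(M) of M. -/
/-- For every infinite set `M`, there is no surjection from `ω × M` onto the
power set `𝒫(M)` of `M`. -/
theorem no_surjection_nat_prod_onto_powerset (M : Type*) [Infinite M] :
    ¬ ∃ f : ℕ × M → Set M, Function.Surjective f := by
  rintro ⟨f, hf⟩
  have h := Cardinal.mk_le_of_surjective hf
  rw [Cardinal.mk_prod, Cardinal.mk_set, Cardinal.mk_nat, Cardinal.lift_aleph0,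
    Cardinal.lift_uzero, Cardinal.aleph0_mul_eq (Cardinal.aleph0_le_mk M)] at h
  exact h.not_gt (Cardinal.cantor _)
end

section
/- For every infinite set M, there is no surjection from ω × M onto the set 𝒫_inf(M) of all infinite subsets of M. -/
/-- The power set of an infinite type embeds into its set of infinite subsets. -/
theorem exists_injective_set_to_infinite_subsets (M : Type*) [Infinite M] :
    ∃ g : Set M → {A : Set M // A.Infinite}, Function.Injective g := by
  obtain ⟨e⟩ : Nonempty (M ⊕ M ≃ M) := Cardinal.eq.1 <| by
    rw [Cardinal.mk_sum, Cardinal.lift_id,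
      Cardinal.add_eq_self (Cardinal.aleph0_le_mk M)]
  refine ⟨fun A => ⟨e '' (Set.range Sum.inl ∪ Sum.inr '' A), ?_⟩, fun A B h => ?_⟩
  · exact ((Set.infinite_range_of_injective Sum.inl_injective).mono
      Set.subset_union_left).image e.injective.injOn
  · have h' := e.injective.image_injective (congrArg Subtype.val h)
    ext x
    simpa using Set.ext_iff.1 h' (Sum.inr x)

/-- For every infinite set `M`, there is no surjection from `ω × M` onto the
set of all infinite subsets of `M`. -/
theorem no_surjection_nat_prod_onto_infinite_subsets (M : Type*) [Infinite M] :
    ¬ ∃ f : ℕ × M → {A : Set M // A.Infinite}, Function.Surjective f := by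
  rintro ⟨f, hf⟩
  obtain ⟨g, hg⟩ := exists_injective_set_to_infinite_subsets M
  obtain ⟨e⟩ : Nonempty (M ≃ ℕ × M) := Cardinal.lift_mk_eq'.1 <| by
    simp [Cardinal.aleph0_mul_eq (Cardinal.aleph0_le_mk M)]
  exact Function.cantor_surjective _
    ((Function.invFun_surjective hg).comp (hf.comp e.surjective))
end

section
/- Let α be an uncountable ordinal and let M be a set. If there is a surjection from ω × M onto the set of ordinals less than α, then there is a surjection from M onto the set of ordinals less than α. -/
/-- If `α` is an uncountable ordinal and there is a surjection from `ω × M`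
onto the set of ordinals less than `α`, then there is a surjection from `M`
onto the set of ordinals less than `α`. -/
theorem surjection_of_surjection_nat_prod (α : Ordinal) (hα : Cardinal.aleph0 < α.card)
    (M : Type*) (f : ℕ × M → {γ : Ordinal // γ < α}) (hf : Function.Surjective f) :
    ∃ g : M → {γ : Ordinal // γ < α}, Function.Surjective g := by
  rcases finite_or_infinite M with hM | hM
  · have hc : Countable (Set.Iio α) := hf.countable
    rw [← Cardinal.mk_le_aleph0_iff, Cardinal.mk_Iio_ordinal, Cardinal.lift_le_aleph0] at hc
    exact absurd hα hc.not_gt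
  · have he : Cardinal.mk M = Cardinal.mk (ℕ × M) := by simp
    obtain ⟨e⟩ := Cardinal.eq.1 he
    exact ⟨f ∘ e, hf.comp e.surjective⟩
end

section
/- Let δ be an ordinal and let A be a set of ordinals whose order type (under the natural ordering of ordinals) is ω^δ. If A = B ∪ C, then the order type of B is ω^δ or the order type of C is ω^δ. -/
open Ordinal Order

section WellOrder

universe u

variable {α : Type u} [LinearOrder α] [WellFoundedLT α]

theorem type_inter_Iio_add_type_inter_Ici (s : Set α) (p : α) :
    typeLT ↥(s ∩ Set.Iio p) + typeLT ↥(s ∩ Set.Ici p) = typeLT s := by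
  rw [← type_sum_lex]
  apply le_antisymm
  · refine (RelEmbedding.ofMonotone
      (Sum.elim (fun x => ⟨x.1, x.2.1⟩) (fun x => ⟨x.1, x.2.1⟩)) ?_).ordinal_type_le
    rintro _ _ (h | h | ⟨a, b⟩)
    · exact h
    · exact h
    · exact Subtype.mk_lt_mk.2 ((Set.mem_Iio.1 a.2.2).trans_le (Set.mem_Ici.1 b.2.2))
  · refine (RelEmbedding.ofMonotone (fun x : s =>
      if h : x.1 < p then Sum.inl (⟨x.1, Set.mem_inter x.2 (Set.mem_Iio.2 h)⟩ : ↥(s ∩ Set.Iio p))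
      else Sum.inr (⟨x.1, Set.mem_inter x.2 (Set.mem_Ici.2 (not_lt.1 h))⟩ : ↥(s ∩ Set.Ici p))) ?_).ordinal_type_le
    intro a b hab
    have hab' : a.1 < b.1 := hab
    split_ifs with ha hb hb
    · exact Sum.Lex.inl hab
    · exact Sum.Lex.sep _ _
    · exact absurd (hab'.trans hb) ha
    · exact Sum.Lex.inr hab

theorem exists_type_inter_Iio_eq {s : Set α} {o : Ordinal.{u}} (h : o < typeLT s) :
    ∃ p, typeLT ↥(s ∩ Set.Iio p) = o := by
  obtain ⟨p, rfl⟩ := typein_surj (fun x y : s => x < y) h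
  refine ⟨p, ?_⟩
  rw [← type_subrel]
  apply le_antisymm
  · refine (RelEmbedding.ofMonotone (r := (· < ·)) (s := Subrel (fun x y : s => x < y) (· < p))
      (fun x : ↥(s ∩ Set.Iio p.1) => ⟨⟨x.1, x.2.1⟩, Set.mem_Iio.1 x.2.2⟩) ?_).ordinal_type_le
    exact fun a b h => h
  · refine (RelEmbedding.ofMonotone (r := Subrel (fun x y : s => x < y) (· < p)) (s := (· < ·))
      (fun x => (⟨x.1.1, x.1.2, Set.mem_Iio.2 x.2⟩ : ↥(s ∩ Set.Iio p.1))) ?_).ordinal_type_le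
    exact fun a b h => h

/-- If a union of two sets can be split whenever its order type reaches `o`, then a union of order
type at least `o * N` contributes `N` copies of `o`, distributed between the two sets. -/
theorem exists_mul_le_type_of_mul_le_type_union {o : Ordinal.{u}} (ho : 0 < o)
    (H : ∀ s t : Set α, o ≤ typeLT ↥(s ∪ t) → o ≤ typeLT s ∨ o ≤ typeLT t) (N : ℕ) :
    ∀ s t : Set α, o * N ≤ typeLT ↥(s ∪ t) →
      ∃ m n : ℕ, m + n = N ∧ o * m ≤ typeLT s ∧ o * n ≤ typeLT t := by
  induction N with
  | zero => exact fun s t _ => ⟨0, 0, by simp⟩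
  | succ N ih =>
    intro s t h
    rw [Nat.cast_succ, mul_add_one] at h
    obtain ⟨p, hp⟩ := exists_type_inter_Iio_eq ((lt_add_of_pos_right _ ho).trans_le h)
    rw [← type_inter_Iio_add_type_inter_Ici (s ∪ t) p, hp, add_le_add_iff_left,
      Set.union_inter_distrib_right] at h
    rw [Set.union_inter_distrib_right] at hp
    obtain ⟨m, n, hN, hm, hn⟩ := ih _ _ hp.ge
    have hs := type_inter_Iio_add_type_inter_Ici s p
    have ht := type_inter_Iio_add_type_inter_Ici t p
    rcases H _ _ h with h | h
    · refine ⟨m + 1, n, by lia, ?_, hn.trans (type_mono Set.inter_subset_left)⟩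
      rw [Nat.cast_succ, mul_add_one, ← hs]
      exact add_le_add hm h
    · refine ⟨m, n + 1, by lia, hm.trans (type_mono Set.inter_subset_left), ?_⟩
      rw [Nat.cast_succ, mul_add_one, ← ht]
      exact add_le_add hn h

theorem omega0_opow_le_type_or_of_le_type_union (δ : Ordinal.{u}) :
    ∀ s t : Set α, ω ^ δ ≤ typeLT ↥(s ∪ t) → ω ^ δ ≤ typeLT s ∨ ω ^ δ ≤ typeLT t := by
  induction δ using Ordinal.limitRecOn with
  | zero =>
    intro s t h
    simp only [opow_zero, one_le_iff_ne_zero, ne_eq, type_eq_zero_iff_isEmpty,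
      Set.isEmpty_coe_sort, Set.union_empty_iff] at h ⊢
    tauto
  | add_one γ ih =>
    intro s t h
    by_contra! hst
    obtain ⟨⟨m, hm⟩, n, hn⟩ :=
      And.imp lt_omega0_opow_succ.1 lt_omega0_opow_succ.1 hst
    have ho : 0 < ω ^ γ := opow_pos _ omega0_pos
    have hmn : ω ^ γ * (m + n : ℕ) ≤ typeLT ↥(s ∪ t) := by
      refine le_trans ?_ h
      rw [← succ_eq_add_one, opow_succ]
      exact mul_le_mul_right (natCast_lt_omega0 _).le _
    obtain ⟨m', n', hN, hm', hn'⟩ := exists_mul_le_type_of_mul_le_type_union ho ih _ s t hmn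
    have h₁ := hm'.trans_lt hm
    have h₂ := hn'.trans_lt hn
    rw [mul_lt_mul_iff_right₀ ho, Nat.cast_lt] at h₁ h₂
    lia
  | limit δ hδ ih =>
    intro s t h
    by_contra! hst
    obtain ⟨⟨a, ha, hsa⟩, b, hb, htb⟩ :=
      And.imp (lt_opow_of_isSuccLimit omega0_ne_zero hδ).1
        (lt_opow_of_isSuccLimit omega0_ne_zero hδ).1 hst
    have hle : ∀ {c d : Ordinal.{u}}, c ≤ d → ω ^ c ≤ ω ^ d :=
      fun h => opow_le_opow_right omega0_pos h
    have hmax : max a b < δ := max_lt ha hb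
    rcases ih _ hmax s t ((hle hmax.le).trans h) with h' | h'
    · exact (hsa.trans_le (hle (le_max_left a b))).not_ge h'
    · exact (htb.trans_le (hle (le_max_right a b))).not_ge h'

end WellOrder

/-- If `A = B ∪ C` is a set of ordinals whose order type is `ω ^ δ`, then the
order type of `B` is `ω ^ δ` or the order type of `C` is `ω ^ δ`. -/
theorem orderType_union (δ : Ordinal) (A B C : Set Ordinal)
    (hA : Ordinal.type ((· < ·) : A → A → Prop) = Ordinal.omega0 ^ δ)
    (hBC : A = B ∪ C) :
    Ordinal.type ((· < ·) : B → B → Prop) = Ordinal.omega0 ^ δ ∨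
      Ordinal.type ((· < ·) : C → C → Prop) = Ordinal.omega0 ^ δ := by
  subst hBC
  exact (omega0_opow_le_type_or_of_le_type_union δ B C hA.ge).imp
    (fun h => le_antisymm ((type_mono Set.subset_union_left).trans_eq hA) h)
    (fun h => le_antisymm ((type_mono Set.subset_union_right).trans_eq hA) h)
end

section
/- Let M be an infinite set and N be any set. If there is a finite-to-one function from N to M, then there is no surjection from N onto the power set 𝒫(M). -/
/-- If `M` is infinite and there is a finite-to-one function from `N` to `M`,
then there is no surjection from `N` onto the power set `𝒫(M)`. -/
theorem no_surjection_onto_powerset_of_finiteToOne (M N : Type*) [Infinite M]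
    (f : N → M) (hf : ∀ x : M, (f ⁻¹' {x}).Finite) :
    ¬ ∃ g : N → Set M, Function.Surjective g := by
  rintro ⟨g, hg⟩
  have hcode : ∀ x : M, ∃ c : N → ℕ, Set.InjOn c (f ⁻¹' {x}) := fun x =>
    Set.countable_iff_exists_injOn.mp (hf x).countable
  choose c hc using hcode
  have hinj : Function.Injective fun n => (f n, c (f n) n) := by
    intro a b hab
    obtain ⟨h₁, h₂⟩ := Prod.mk.inj hab
    rw [← h₁] at h₂
    exact hc (f a) rfl h₁.symm h₂
  have hcard : Cardinal.mk (M × ℕ) = Cardinal.mk M := by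
    simp [Cardinal.mul_aleph0_eq (Cardinal.aleph0_le_mk M)]
  obtain ⟨e⟩ := Cardinal.eq.mp hcard
  exact Function.cantor_injective _
    ((e.injective.comp hinj).comp (Function.injective_surjInv hg))
end

section
/- Let α be an infinite ordinal, M a set, and N a set. If there is a finite-to-one function from N to M and a surjection from N onto the set of ordinals less than α, then there is a surjection from M onto the set of ordinals less than α. -/
theorem nonempty_embedding_of_finite_preimage_singleton {M N : Type*} [Infinite N] (f : N → M)
    (hf : ∀ x : M, (f ⁻¹' {x}).Finite) : Nonempty (N ↪ M) := by
  have : Infinite M := by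
    by_contra h
    have : Finite M := not_infinite_iff_finite.mp h
    exact Set.infinite_univ (Set.Finite.preimage' (Set.finite_univ (α := M)) fun x _ => hf x)
  choose e he using fun x => Set.countable_iff_exists_injective.mp (hf x).countable
  let F : N ↪ M × ℕ := ⟨fun n => (f n, e (f n) ⟨n, rfl⟩), fun a b hab => by
    obtain ⟨h₁, h₂⟩ := Prod.mk.inj hab
    have key : ∀ y (hy : f a = y) (hb : f b = y), e (f a) ⟨a, rfl⟩ = e (f b) ⟨b, rfl⟩ → a = b := by
      rintro y hy hb h
      have ha' : e (f a) ⟨a, rfl⟩ = e y ⟨a, hy⟩ := by subst hy; rfl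
      have hb' : e (f b) ⟨b, rfl⟩ = e y ⟨b, hb⟩ := by subst hb; rfl
      exact congrArg Subtype.val (he y (ha'.symm.trans (h.trans hb')))
    exact key (f b) h₁ rfl h₂⟩
  have hcard : Cardinal.mk (M × ℕ) = Cardinal.mk M := by simp
  obtain ⟨E⟩ := Cardinal.eq.mp hcard
  exact ⟨F.trans E.toEmbedding⟩

theorem Ordinal.infinite_subtype_lt {α : Ordinal} (hα : Ordinal.omega0 ≤ α) :
    Infinite {γ : Ordinal // γ < α} :=
  Infinite.of_injective (fun n : ℕ => ⟨n, (Ordinal.natCast_lt_omega0 n).trans_le hα⟩)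
    fun _ _ h => Nat.cast_injective (congrArg Subtype.val h)

/-- If `α` is an infinite ordinal, there is a finite-to-one function from `N` to `M`,
and a surjection from `N` onto the set of ordinals less than `α`, then there is a
surjection from `M` onto the set of ordinals less than `α`. -/
theorem surjection_of_finiteToOne_and_surjection (α : Ordinal) (hα : Ordinal.omega0 ≤ α)
    (M N : Type*) (f : N → M) (hf : ∀ x : M, (f ⁻¹' {x}).Finite)
    (g : N → {γ : Ordinal // γ < α}) (hg : Function.Surjective g) :
    ∃ h : M → {γ : Ordinal // γ < α}, Function.Surjective h := by
  have := Ordinal.infinite_subtype_lt hα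
  have := Infinite.of_surjective g hg
  obtain ⟨F⟩ := nonempty_embedding_of_finite_preimage_singleton f hf
  exact ⟨g ∘ Function.invFun F, hg.comp (Function.invFun_surjective F.injective)⟩
end

section
/- For every infinite set M and every natural number n, there is no finite-to-one function from the set 𝒫_inf(M) of all infinite subsets of M to the n-fold Cartesian power Mⁿ. -/
open Cardinal in
/-- An infinite set `M` has at least `2 ^ #M` infinite subsets. -/
theorem Cardinal.two_power_mk_le_mk_infinite_subsets (M : Type*) [Infinite M] :
    2 ^ #M ≤ #{A : Set M // A.Infinite} := by
  obtain ⟨e⟩ : Nonempty (M ⊕ M ≃ M) :=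
    Cardinal.eq.1 (by rw [← Cardinal.add_def, Cardinal.add_eq_self (aleph0_le_mk M)])
  rw [← Cardinal.mk_set]
  refine Cardinal.mk_le_of_injective
    (f := fun S : Set M ↦ ⟨e '' (Sum.inl '' S ∪ Set.range Sum.inr), ?_⟩) ?_
  · exact ((Set.infinite_range_of_injective Sum.inr_injective).mono
      Set.subset_union_right).image e.injective.injOn
  · intro S T h
    have h' := e.injective.image_injective (Subtype.ext_iff.1 h)
    ext x
    simpa using Set.ext_iff.1 h' (Sum.inl x)

/-- For every infinite set `M` and every natural number `n`, there is no
finite-to-one function from the set of all infinite subsets of `M` to `Mⁿ`. -/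
theorem no_finiteToOne_infinite_subsets_to_pow (M : Type*) [Infinite M] (n : ℕ) :
    ¬ ∃ f : {A : Set M // A.Infinite} → (Fin n → M),
        ∀ y : Fin n → M, (f ⁻¹' {y}).Finite := by
  rintro ⟨f, hf⟩
  have hM := Cardinal.aleph0_le_mk M
  have hfib := Cardinal.mk_le_mk_mul_of_mk_preimage_le f
    fun y ↦ (Cardinal.lt_aleph0_iff_set_finite.2 (hf y)).le
  have hpow : Cardinal.mk (Fin n → M) ≤ Cardinal.mk M := by
    simpa using Cardinal.power_nat_le (n := n) hM
  refine (Cardinal.cantor (Cardinal.mk M)).not_ge ?_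
  calc
    2 ^ Cardinal.mk M ≤ Cardinal.mk {A : Set M // A.Infinite} :=
      Cardinal.two_power_mk_le_mk_infinite_subsets M
    _ ≤ Cardinal.mk (Fin n → M) * Cardinal.aleph0 := hfib
    _ ≤ Cardinal.mk M * Cardinal.aleph0 := by gcongr
    _ = Cardinal.mk M := Cardinal.mul_aleph0_eq hM
end

section
/- For every infinite set M and every natural number n, there is no finite-to-one function from the set 𝒫_inf(M) of all infinite subsets of M to the set [M]ⁿ of n-element subsets of M. -/
/-- An infinite type has at least as many infinite subsets as it has subsets. -/
theorem Cardinal.mk_set_le_mk_infinite_sets (M : Type*) [Infinite M] :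
    Cardinal.mk (Set M) ≤ Cardinal.mk {A : Set M // A.Infinite} := by
  obtain ⟨e⟩ : Nonempty (M ⊕ M ≃ M) := by
    rw [← Cardinal.eq, Cardinal.mk_sum, Cardinal.lift_id,
      Cardinal.add_eq_self (Cardinal.aleph0_le_mk M)]
  refine Cardinal.mk_le_of_injective
    (f := fun A : Set M => (⟨e '' (Set.range Sum.inl ∪ Sum.inr '' A), ?_⟩ :
      {A : Set M // A.Infinite})) ?_
  · exact ((Set.infinite_range_of_injective Sum.inl_injective).mono
      Set.subset_union_left).image e.injective.injOn
  · intro A B h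
    have h' := e.injective.image_injective (Subtype.ext_iff.mp h)
    ext x
    simpa using Set.ext_iff.mp h' (Sum.inr x)

/-- For every infinite set `M` and every natural number `n`, there is no
finite-to-one function from the set of all infinite subsets of `M` to the set
`[M]ⁿ` of `n`-element subsets of `M`. -/
theorem no_finiteToOne_infinite_subsets_to_nsubsets (M : Type*) [Infinite M] (n : ℕ) :
    ¬ ∃ f : {A : Set M // A.Infinite} → {s : Finset M // s.card = n},
        ∀ y : {s : Finset M // s.card = n}, (f ⁻¹' {y}).Finite := by
  rintro ⟨f, hf⟩
  have hM := Cardinal.aleph0_le_mk M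
  have hfib : Cardinal.mk {A : Set M // A.Infinite} ≤
      Cardinal.mk {s : Finset M // s.card = n} * Cardinal.aleph0 :=
    Cardinal.mk_le_mk_mul_of_mk_preimage_le f fun y => (hf y).lt_aleph0.le
  have hn : Cardinal.mk {s : Finset M // s.card = n} ≤ Cardinal.mk M :=
    (Cardinal.mk_subtype_le _).trans (Cardinal.mk_finset_of_infinite M).le
  refine (Cardinal.cantor (Cardinal.mk M)).not_ge ?_
  calc 2 ^ Cardinal.mk M = Cardinal.mk (Set M) := Cardinal.mk_set.symm
    _ ≤ Cardinal.mk {A : Set M // A.Infinite} := Cardinal.mk_set_le_mk_infinite_sets M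
    _ ≤ Cardinal.mk {s : Finset M // s.card = n} * Cardinal.aleph0 := hfib
    _ ≤ Cardinal.mk M * Cardinal.mk M := mul_le_mul' hn hM
    _ = Cardinal.mk M := Cardinal.mul_eq_self hM
end

section
/- For every infinite set M, there is no finite-to-one function from the set 𝒫_inf(M) of all infinite subsets of M to ω × M. -/
open Cardinal

universe u

/-- The domain of a finite-to-one function into an infinite type is no larger than the codomain. -/
theorem mk_le_of_finite_preimage {α β : Type u} [Infinite β] (f : α → β)
    (hf : ∀ y, (f ⁻¹' {y}).Finite) : #α ≤ #β :=
  (mk_le_mk_mul_of_mk_preimage_le f fun y => (hf y).lt_aleph0.le).trans_eq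
    (mul_aleph0_eq (aleph0_le_mk β))

/-- An infinite type has more infinite subsets than elements. -/
theorem mk_lt_mk_infinite_subsets (M : Type u) [Infinite M] :
    #M < #{A : Set M // A.Infinite} := by
  by_contra! h
  have hfin : #{A : Set M // A.Finite} = #M :=
    (mk_congr OrderIso.finsetSetFinite.toEquiv).symm.trans (mk_finset_of_infinite M)
  have hsum : #{A : Set M // A.Finite} + #{A : Set M // A.Infinite} = #(Set M) :=
    mk_sum_compl {A : Set M | A.Finite}
  have hle : #(Set M) ≤ #M := by
    rw [← hsum, hfin]
    exact (add_le_add_right h _).trans_eq (add_eq_self (aleph0_le_mk M))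
  rw [mk_set] at hle
  exact (cantor #M).not_ge hle

/-- For every infinite set `M`, there is no finite-to-one function from the set
of all infinite subsets of `M` to `ω × M`. -/
theorem no_finiteToOne_infinite_subsets_to_nat_prod (M : Type*) [Infinite M] :
    ¬ ∃ f : {A : Set M // A.Infinite} → ℕ × M,
        ∀ y : ℕ × M, (f ⁻¹' {y}).Finite := by
  rintro ⟨f, hf⟩
  refine (mk_lt_mk_infinite_subsets M).not_ge ((mk_le_of_finite_preimage f hf).trans_eq ?_)
  simp [aleph0_mul_eq (aleph0_le_mk M)]
end

section
/- For every infinite set M, there is no finite-to-one function from the power set 𝒫(M) to ω × M. -/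
/-- For every infinite set `M`, there is no finite-to-one function from the
power set `𝒫(M)` to `ω × M`. -/
theorem no_finiteToOne_powerset_to_nat_prod (M : Type*) [Infinite M] :
    ¬ ∃ f : Set M → ℕ × M, ∀ y : ℕ × M, (f ⁻¹' {y}).Finite := by
  rintro ⟨f, hf⟩
  have hM : Cardinal.aleph0 ≤ Cardinal.mk M := Cardinal.aleph0_le_mk M
  have hprod : Cardinal.mk (ℕ × M) = Cardinal.mk M := by simp [hM]
  have hle : Cardinal.mk (Set M) ≤ Cardinal.mk (ℕ × M) * Cardinal.aleph0 :=
    Cardinal.mk_le_mk_mul_of_mk_preimage_le f fun y => (hf y).lt_aleph0.le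
  rw [hprod, Cardinal.mul_aleph0_eq hM, Cardinal.mk_set] at hle
  exact (Cardinal.cantor _).not_ge hle
end

section
/- For every infinite set M, there is no surjection from M onto the set 𝒫_inf(M) of all infinite subsets of M. -/
/-- For every infinite set `M`, there is no surjection from `M` onto the set of
all infinite subsets of `M`. -/
theorem no_surjection_onto_infinite_subsets (M : Type*) [Infinite M] :
    ¬ ∃ f : M → {A : Set M // A.Infinite}, Function.Surjective f := by
  rintro ⟨f, hf⟩
  obtain ⟨e⟩ : Nonempty (M ⊕ M ≃ M) :=
    Cardinal.eq.1 (by simp)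
  refine Function.cantor_surjective (fun m => {x | e (Sum.inl x) ∈ (f m).1}) fun A => ?_
  have hinf : (e '' (Sum.inl '' A ∪ Set.range Sum.inr)).Infinite :=
    ((Set.infinite_range_of_injective Sum.inr_injective).mono
      Set.subset_union_right).image e.injective.injOn
  obtain ⟨m, hm⟩ := hf ⟨_, hinf⟩
  refine ⟨m, ?_⟩
  ext x
  simp [hm]
end
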